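/- arXiv:1306.5295 — 2 statements merged into one kernel-verified Lean document; each statement's English description precedes it below -/
import Mathlib

section
/- Let δ ∈ (0,1] and ε ∈ [0,1] with √3·(2(1−ε)δ/5 + ε) < 1. Let u ∈ ℝ³ with ‖u‖ = 1, and let w ∈ ℝ³ satisfy |w_i − u_i| ≤ 2(1−ε)δ/5 + ε for each coordinate i ∈ {1,2,3}. Then w ≠ 0 and ‖u − w/‖w‖‖ ≤ (1−ε)·δ + (5/2)·ε. -/
open Real

/-- A coordinatewise error of at most `η` is a Euclidean error of at most `√3 η`. -/
theorem norm_sub_sq_le_of_coord_le {u w : EuclideanSpace ℝ (Fin 3)} {η : ℝ}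
    (hw : ∀ i : Fin 3, |w i - u i| ≤ η) : ‖u - w‖ ^ 2 ≤ 3 * η ^ 2 := by
  have hsq (i : Fin 3) : (u i - w i) ^ 2 ≤ η ^ 2 :=
    sq_le_sq' (by linarith [(abs_le.mp (hw i)).2]) (by linarith [(abs_le.mp (hw i)).1])
  rw [EuclideanSpace.real_norm_sq_eq, Fin.sum_univ_three]
  simp only [PiLp.sub_apply]
  linarith [hsq 0, hsq 1, hsq 2]

/-- Normalizing a vector at distance `√q < 1` from a unit vector increases the distance
by a factor of at most `√2`. -/
theorem norm_sub_normalize_sq_le {E : Type*} [NormedAddCommGroup E] [InnerProductSpace ℝ E]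
    {u w : E} {q : ℝ} (hu : ‖u‖ = 1) (hq : q < 1) (huw : ‖u - w‖ ^ 2 ≤ q) :
    w ≠ 0 ∧ ‖u - ‖w‖⁻¹ • w‖ ^ 2 ≤ 2 * q := by
  have hw : w ≠ 0 := by
    rintro rfl
    rw [sub_zero, hu] at huw
    linarith
  refine ⟨hw, ?_⟩
  have hn : 0 < ‖w‖ := norm_pos_iff.mpr hw
  have hq0 : 0 ≤ q := (sq_nonneg _).trans huw
  rw [norm_sub_sq_real, hu] at huw
  have hinner : (1 - q) * ‖w‖ ≤ inner ℝ u w := by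
    nlinarith [sq_nonneg (‖w‖ - (1 - q)), mul_nonneg hq0 (sub_nonneg.mpr hq.le)]
  have hdiv : 1 - q ≤ ‖w‖⁻¹ * inner ℝ u w := by
    rw [inv_mul_eq_div]
    exact (le_div_iff₀ hn).mpr hinner
  rw [norm_sub_sq_real, hu, real_inner_smul_right, norm_smul, norm_inv, norm_norm,
    inv_mul_cancel₀ hn.ne']
  linarith

theorem twoED_depolarizing_accuracy (δ ε : ℝ)
    (hδ : δ ∈ Set.Ioc (0:ℝ) 1) (hε : ε ∈ Set.Icc (0:ℝ) 1)
    (hsmall : Real.sqrt 3 * (2 * (1 - ε) * δ / 5 + ε) < 1)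
    (u w : EuclideanSpace ℝ (Fin 3)) (hu : ‖u‖ = 1)
    (hw : ∀ i : Fin 3, |w i - u i| ≤ 2 * (1 - ε) * δ / 5 + ε) :
    w ≠ 0 ∧ ‖u - ‖w‖⁻¹ • w‖ ≤ (1 - ε) * δ + (5 / 2) * ε := by
  have hbound : (1 - ε) * δ + (5 / 2) * ε = 5 / 2 * (2 * (1 - ε) * δ / 5 + ε) := by ring
  have hη : 0 ≤ 2 * (1 - ε) * δ / 5 + ε := (abs_nonneg _).trans (hw 0)
  rw [hbound]
  generalize h_eq : 2 * (1 - ε) * δ / 5 + ε = η at hsmall hη ⊢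
  simp only [h_eq] at hw
  have hq : 3 * η ^ 2 < 1 := by
    have h := pow_lt_one₀ (by positivity) hsmall two_ne_zero
    rwa [mul_pow, Real.sq_sqrt (by norm_num)] at h
  obtain ⟨hw0, hdist⟩ := norm_sub_normalize_sq_le hu hq (norm_sub_sq_le_of_coord_le hw)
  refine ⟨hw0, (sq_le_sq₀ (norm_nonneg _) (by positivity)).mp ?_⟩
  nlinarith [sq_nonneg η]
end

section
/- Let δ ∈ (0,1], let u = (u₁, u₂, u₃) ∈ ℝ³ with ‖u‖ = 1, and let p₁, p₂, p₃ ∈ ℝ satisfy |p_i − (1 + u_i)/2| ≤ δ/5 for each i ∈ {1,2,3}. Define w = (2p₁ − 1, 2p₂ − 1, 2p₃ − 1). Then w ≠ 0 and ‖u − w/‖w‖‖ ≤ δ. -/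
open Real

/-- If `‖u‖ = 1` and `w` is within `√(12/25) δ` of `u`, with `δ ∈ (0, 1]`, then `w` is nonzero and
its normalization is within `δ` of `u`. -/
theorem norm_sub_normalize_le {E : Type*} [NormedAddCommGroup E] [InnerProductSpace ℝ E]
    {δ : ℝ} (hδ₀ : 0 < δ) (hδ₁ : δ ≤ 1) {u w : E} (hu : ‖u‖ = 1)
    (h : ‖u - w‖ ^ 2 ≤ 12 / 25 * δ ^ 2) :
    w ≠ 0 ∧ ‖u - ‖w‖⁻¹ • w‖ ≤ δ := by
  have hδ₂ : δ ^ 2 ≤ 1 := pow_le_one₀ hδ₀.le hδ₁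
  have hw : w ≠ 0 := by
    rintro rfl
    rw [sub_zero, hu] at h
    linarith
  refine ⟨hw, ?_⟩
  have hn : 0 < ‖w‖ := norm_pos_iff.mpr hw
  have hinner : ‖w‖ * (1 - δ ^ 2 / 2) ≤ inner ℝ u w := by
    rw [norm_sub_sq_real, hu] at h
    nlinarith [sq_nonneg (‖w‖ - (1 - δ ^ 2 / 2)), sq_nonneg δ,
      mul_nonneg (sq_nonneg δ) (sub_nonneg.mpr hδ₂)]
  have hunit : ‖‖w‖⁻¹ • w‖ = 1 := norm_smul_inv_norm (𝕜 := ℝ) hw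
  have hcos : 1 - δ ^ 2 / 2 ≤ ‖w‖⁻¹ * inner ℝ u w := by
    rwa [← div_eq_inv_mul, le_div_iff₀ hn, mul_comm]
  refine le_of_sq_le_sq ?_ hδ₀.le
  rw [norm_sub_sq_real, hu, hunit, real_inner_smul_right]
  linarith

theorem twoED_core_correctness (δ : ℝ) (hδ : δ ∈ Set.Ioc (0:ℝ) 1)
    (u : EuclideanSpace ℝ (Fin 3)) (hu : ‖u‖ = 1)
    (p : Fin 3 → ℝ) (hp : ∀ i : Fin 3, |p i - (1 + u i) / 2| ≤ δ / 5)
    (w : EuclideanSpace ℝ (Fin 3)) (hwdef : ∀ i : Fin 3, w i = 2 * p i - 1) :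
    w ≠ 0 ∧ ‖u - ‖w‖⁻¹ • w‖ ≤ δ := by
  refine norm_sub_normalize_le hδ.1 hδ.2 hu ?_
  have hcoord (i : Fin 3) : (u i - w i) ^ 2 ≤ 4 / 25 * δ ^ 2 := by
    have := sq_le_sq' (abs_le.mp (hp i)).1 (abs_le.mp (hp i)).2
    rw [hwdef i]
    nlinarith
  rw [EuclideanSpace.real_norm_sq_eq, Fin.sum_univ_three]
  simp only [PiLp.sub_apply]
  linarith [hcoord 0, hcoord 1, hcoord 2]
end
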